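/- Let σ be a holomorphic function on ℂ² whose zero set is W, and suppose that at every point of W at least one of the partial derivatives ∂σ/∂u₁, ∂σ/∂u₃ is nonzero (so the germ of σ is irreducible at every point of W). If F is a holomorphic function on ℂ² that vanishes identically on W, then there exists a holomorphic function G on ℂ² with F = σG. -/

import Mathlib

open Filter Topology Metric Set

/-- If the slices `f (·, y)` are holomorphic on a closed disc and `f` is continuous at the points
of the bounding circle in the slice `y = y₀`, then the slices converge uniformly on the disc as
`y → y₀`. -/
theorem tendstoUniformlyOn_slices {f : ℂ × ℂ → ℂ} {x₀ y₀ : ℂ} {ρ : ℝ} (hρ : 0 < ρ)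
    (hd : ∀ᶠ y in 𝓝 y₀, ∀ x ∈ closedBall x₀ ρ, DifferentiableAt ℂ (fun x => f (x, y)) x)
    (hc : ∀ x ∈ sphere x₀ ρ, ContinuousAt f (x, y₀)) :
    TendstoUniformlyOn (fun y x => f (x, y)) (fun x => f (x, y₀)) (𝓝 y₀) (closedBall x₀ ρ) := by
  rw [Metric.tendstoUniformlyOn_iff]
  intro ε hε
  have hcirc : ∀ᶠ y in 𝓝 y₀, ∀ x ∈ sphere x₀ ρ, ‖f (x, y₀) - f (x, y)‖ < ε / 2 := by
    apply (isCompact_sphere x₀ ρ).eventually_forall_of_forall_eventually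
      (P := fun y x => ‖f (x, y₀) - f (x, y)‖ < ε / 2)
    intro x hx
    have h₁ : ContinuousAt (fun z : ℂ × ℂ => f (z.2, y₀)) (y₀, x) :=
      ContinuousAt.comp (f := fun z : ℂ × ℂ => (z.2, y₀)) (x := (y₀, x)) (hc x hx) (by fun_prop)
    have h₂ : ContinuousAt (fun z : ℂ × ℂ => f (z.2, z.1)) (y₀, x) :=
      ContinuousAt.comp (f := fun z : ℂ × ℂ => (z.2, z.1)) (x := (y₀, x)) (hc x hx) (by fun_prop)
    have h₃ := (h₁.sub h₂).norm
    exact h₃.eventually (gt_mem_nhds (by simpa using half_pos hε))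
  have hd₀ := hd.self_of_nhds
  filter_upwards [hd, hcirc] with y hy hyc x hx
  rw [dist_eq_norm]
  refine lt_of_le_of_lt (Complex.norm_le_of_forall_mem_frontier_norm_le
    (f := fun x => f (x, y₀) - f (x, y)) (U := ball x₀ ρ) (C := ε / 2) isBounded_ball ?_ ?_ ?_)
    (half_lt_self hε)
  · refine DifferentiableOn.diffContOnCl_ball (U := closedBall x₀ ρ) ?_ le_rfl
    intro z hz
    exact ((hd₀ z hz).sub (hy z hz)).differentiableWithinAt
  · intro z hz
    rw [frontier_ball x₀ hρ.ne'] at hz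
    exact (hyc z hz).le
  · rwa [closure_ball x₀ hρ.ne']

theorem TendstoLocallyUniformlyOn.continuousAt_uncurry {g : ℂ → ℂ → ℂ} {x₀ y₀ : ℂ} {U : Set ℂ}
    (hU : IsOpen U) (hx : x₀ ∈ U) (h : TendstoLocallyUniformlyOn g (g y₀) (𝓝 y₀) U)
    (hc : ContinuousAt (g y₀) x₀) : ContinuousAt (fun v : ℂ × ℂ => g v.2 v.1) (x₀, y₀) := by
  rw [Metric.continuousAt_iff']
  intro ε hε
  obtain ⟨t, ht, hev⟩ := Metric.tendstoLocallyUniformlyOn_iff.1 h (ε / 2) (half_pos hε) x₀ hx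
  rw [hU.nhdsWithin_eq hx] at ht
  have hc' := Metric.continuousAt_iff'.1 hc (ε / 2) (half_pos hε)
  rw [nhds_prod_eq]
  filter_upwards [((eventually_mem_set.2 ht).and hc').prod_mk hev] with v hv
  have h₁ := hv.2 v.1 hv.1.1
  have h₂ : dist (g y₀ v.1) (g y₀ x₀) < ε / 2 := hv.1.2
  rw [dist_comm] at h₁
  linarith [dist_triangle (g v.2 v.1) (g y₀ v.1) (g y₀ x₀)]

/-- The derivative along the first variable of a continuous function that is holomorphic in that
variable is continuous. -/
theorem continuousAt_deriv_fst {f : ℂ × ℂ → ℂ} {u : ℂ × ℂ} (hc : ∀ᶠ v in 𝓝 u, ContinuousAt f v)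
    (hd : ∀ᶠ v in 𝓝 u, DifferentiableAt ℂ (fun x => f (x, v.2)) v.1) :
    ContinuousAt (fun v : ℂ × ℂ => deriv (fun x => f (x, v.2)) v.1) u := by
  obtain ⟨x₀, y₀⟩ := u
  obtain ⟨r, hr, hball⟩ := Metric.eventually_nhds_iff_ball.1 (hc.and hd)
  have hmem : ∀ x ∈ closedBall x₀ (r / 2), ∀ y ∈ ball y₀ r, (x, y) ∈ ball (x₀, y₀) r := by
    intro x hx y hy
    rw [← ball_prod_same]
    exact ⟨closedBall_subset_ball (half_lt_self hr) hx, hy⟩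
  have hd' : ∀ᶠ y in 𝓝 y₀, ∀ x ∈ closedBall x₀ (r / 2),
      DifferentiableAt ℂ (fun x => f (x, y)) x := by
    filter_upwards [ball_mem_nhds y₀ hr] with y hy x hx
    exact (hball _ (hmem x hx y hy)).2
  have hunif := tendstoUniformlyOn_slices (half_pos hr) hd' fun x hx =>
    (hball _ (hmem x (sphere_subset_closedBall hx) y₀ (mem_ball_self hr))).1
  have hdiff : ∀ᶠ y in 𝓝 y₀, DifferentiableOn ℂ (fun x => f (x, y)) (ball x₀ (r / 2)) := by
    filter_upwards [hd'] with y hy x hx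
    exact (hy x (ball_subset_closedBall hx)).differentiableWithinAt
  have hlim := (hunif.mono ball_subset_closedBall).tendstoLocallyUniformlyOn.deriv hdiff isOpen_ball
  have hx₀ := mem_ball_self (x := x₀) (half_pos hr)
  exact TendstoLocallyUniformlyOn.continuousAt_uncurry
    (g := fun y => deriv (fun x => f (x, y))) isOpen_ball hx₀ hlim
    ((hdiff.self_of_nhds.deriv isOpen_ball).differentiableAt
      (isOpen_ball.mem_nhds hx₀)).continuousAt

theorem continuousAt_deriv_snd {f : ℂ × ℂ → ℂ} {u : ℂ × ℂ} (hc : ∀ᶠ v in 𝓝 u, ContinuousAt f v)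
    (hd : ∀ᶠ v in 𝓝 u, DifferentiableAt ℂ (fun y => f (v.1, y)) v.2) :
    ContinuousAt (fun v : ℂ × ℂ => deriv (fun y => f (v.1, y)) v.2) u := by
  have hswap : Tendsto Prod.swap (𝓝 u.swap) (𝓝 u) := continuous_swap.tendsto u.swap
  have hc' : ∀ᶠ v in 𝓝 u.swap, ContinuousAt (f ∘ Prod.swap) v := by
    filter_upwards [hswap.eventually hc] with v hv
    exact ContinuousAt.comp (f := Prod.swap) hv continuous_swap.continuousAt
  have h := continuousAt_deriv_fst hc' (hswap.eventually hd)
  exact ContinuousAt.comp (f := Prod.swap) (x := u) h continuous_swap.continuousAt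

/-- Osgood's lemma: a continuous separately holomorphic function is holomorphic. -/
theorem differentiableAt_of_separately {f : ℂ × ℂ → ℂ} {u : ℂ × ℂ}
    (hc : ∀ᶠ v in 𝓝 u, ContinuousAt f v)
    (hd₁ : ∀ᶠ v in 𝓝 u, DifferentiableAt ℂ (fun x => f (x, v.2)) v.1)
    (hd₂ : ∀ᶠ v in 𝓝 u, DifferentiableAt ℂ (fun y => f (v.1, y)) v.2) :
    DifferentiableAt ℂ f u := by
  let T := ContinuousLinearMap.toSpanSingletonCLE (𝕜 := ℂ) (E := ℂ)
  have h := hasStrictFDerivAt_uncurry_coprod (𝕜 := ℂ) (u := u) (f := fun x y => f (x, y))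
    (f₁ := fun x y => T (deriv (fun x => f (x, y)) x))
    (f₂ := fun x y => T (deriv (fun y => f (x, y)) y))
    (hd₁.mono fun v hv => hv.hasDerivAt.hasFDerivAt)
    (hd₂.mono fun v hv => hv.hasDerivAt.hasFDerivAt)
    (T.continuous.continuousAt.comp (continuousAt_deriv_fst hc hd₁))
    (T.continuous.continuousAt.comp (continuousAt_deriv_snd hc hd₂))
  exact h.hasFDerivAt.differentiableAt

/-- The quotient `F / σ`, extended to the zeros of `σ` by the ratio of derivatives along the first
variable. -/
noncomputable def quotientFst (σ F : ℂ × ℂ → ℂ) (v : ℂ × ℂ) : ℂ :=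
  if σ v = 0 then deriv (fun x => F (x, v.2)) v.1 / deriv (fun x => σ (x, v.2)) v.1
  else F v / σ v

section quotientFst

variable {σ F : ℂ × ℂ → ℂ} {v : ℂ × ℂ}

theorem mul_quotientFst (hvan : σ v = 0 → F v = 0) : F v = σ v * quotientFst σ F v := by
  unfold quotientFst
  split_ifs with h
  · simp [h, hvan h]
  · rw [mul_div_cancel₀ _ h]

theorem differentiableAt_quotientFst_of_ne_zero (hσ : Differentiable ℂ σ) (hF : Differentiable ℂ F)
    (h : σ v ≠ 0) : DifferentiableAt ℂ (quotientFst σ F) v := by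
  refine ((hF v).mul ((hσ v).inv h)).congr_of_eventuallyEq ?_
  filter_upwards [hσ.continuous.continuousAt.eventually_ne h] with w hw
  simp [quotientFst, hw, div_eq_mul_inv]

theorem differentiableAt_quotientFst_fst (hσ : Differentiable ℂ σ) (hF : Differentiable ℂ F)
    (hvan : ∀ u, σ u = 0 → F u = 0) (hne : deriv (fun x => σ (x, v.2)) v.1 ≠ 0) :
    DifferentiableAt ℂ (fun x => quotientFst σ F (x, v.2)) v.1 := by
  obtain ⟨x₀, y⟩ := v
  dsimp only at hne ⊢
  by_cases h : σ (x₀, y) = 0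
  · have hs : Differentiable ℂ fun x => σ (x, y) := by fun_prop
    have hf : Differentiable ℂ fun x => F (x, y) := by fun_prop
    have hds : ∀ {g : ℂ → ℂ}, Differentiable ℂ g → DifferentiableAt ℂ (dslope g x₀) x₀ :=
      fun hg => ((Complex.differentiableOn_dslope univ_mem).2 hg.differentiableOn).differentiableAt
        univ_mem
    refine ((hds hf).div (hds hs) (by rwa [dslope_same])).congr_of_eventuallyEq ?_
    have hz := (hs x₀).hasDerivAt.eventually_ne (c := 0) hne
    rw [eventually_nhdsWithin_iff] at hz
    filter_upwards [hz] with x hx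
    rcases eq_or_ne x x₀ with rfl | hxx
    · simp [quotientFst, h, dslope_same]
    · have hx' : x - x₀ ≠ 0 := sub_ne_zero.2 hxx
      simp only [quotientFst, hx hxx, if_false, Pi.div_apply, dslope_of_ne _ hxx, slope_def_field,
        h, hvan _ h, sub_zero]
      rw [div_div_div_cancel_right₀ hx']
  · exact DifferentiableAt.comp (f := fun x => (x, y)) x₀
      (differentiableAt_quotientFst_of_ne_zero hσ hF h) (by fun_prop)

theorem continuousAt_quotientFst (hσ : Differentiable ℂ σ) (hF : Differentiable ℂ F)
    (hvan : ∀ u, σ u = 0 → F u = 0) (hne : ∀ᶠ w in 𝓝 v, deriv (fun x => σ (x, w.2)) w.1 ≠ 0) :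
    ContinuousAt (quotientFst σ F) v := by
  obtain ⟨x₀, y₀⟩ := v
  obtain ⟨r, hr, hball⟩ := Metric.eventually_nhds_iff_ball.1 hne
  have hs : Differentiable ℂ fun x => σ (x, y₀) := by fun_prop
  have hz := (hs x₀).hasDerivAt.eventually_ne (c := 0) hne.self_of_nhds
  rw [eventually_nhdsWithin_iff] at hz
  obtain ⟨s, hspos, hsball⟩ := Metric.eventually_nhds_iff_ball.1 hz
  obtain ⟨ρ, hρ, hρrs⟩ := exists_between (lt_min hr hspos)
  have hd : ∀ᶠ y in 𝓝 y₀, ∀ x ∈ closedBall x₀ ρ,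
      DifferentiableAt ℂ (fun x => quotientFst σ F (x, y)) x := by
    filter_upwards [ball_mem_nhds y₀ hr] with y hy x hx
    refine differentiableAt_quotientFst_fst (v := (x, y)) hσ hF hvan (hball (x, y) ?_)
    rw [← ball_prod_same]
    exact ⟨closedBall_subset_ball (hρrs.trans_le (min_le_left _ _)) hx, hy⟩
  have hunif := tendstoUniformlyOn_slices hρ hd fun x hx =>
    (differentiableAt_quotientFst_of_ne_zero hσ hF
      (hsball x (sphere_subset_ball (hρrs.trans_le (min_le_right _ _)) hx)
        (ne_of_mem_sphere hx hρ.ne'))).continuousAt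
  exact TendstoLocallyUniformlyOn.continuousAt_uncurry (g := fun y x => quotientFst σ F (x, y))
    isOpen_ball (mem_ball_self hρ) (hunif.mono ball_subset_closedBall).tendstoLocallyUniformlyOn
    (hd.self_of_nhds x₀ (mem_closedBall_self hρ.le)).continuousAt

theorem differentiableAt_quotientFst_snd (hσ : Differentiable ℂ σ) (hF : Differentiable ℂ F)
    (hc : ContinuousAt (quotientFst σ F) v) (hne : deriv (fun y => σ (v.1, y)) v.2 ≠ 0) :
    DifferentiableAt ℂ (fun y => quotientFst σ F (v.1, y)) v.2 := by
  obtain ⟨x, y₀⟩ := v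
  dsimp only at hne ⊢
  have hs : Differentiable ℂ fun y => σ (x, y) := by fun_prop
  refine (Complex.analyticAt_of_differentiable_on_punctured_nhds_of_continuousAt ?_
    (ContinuousAt.comp (f := fun y => (x, y)) (x := y₀) hc (by fun_prop))).differentiableAt
  filter_upwards [(hs y₀).hasDerivAt.eventually_ne (c := 0) hne] with y hy
  exact DifferentiableAt.comp (f := fun y => (x, y)) y
      (differentiableAt_quotientFst_of_ne_zero hσ hF hy) (by fun_prop)

theorem eventually_differentiableAt_quotientFst (hσ : Differentiable ℂ σ) (hF : Differentiable ℂ F)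
    (hvan : ∀ u, σ u = 0 → F u = 0) (hne₁ : deriv (fun x => σ (x, v.2)) v.1 ≠ 0)
    (hne₂ : deriv (fun y => σ (v.1, y)) v.2 ≠ 0) :
    ∀ᶠ w in 𝓝 v, DifferentiableAt ℂ (quotientFst σ F) w := by
  have hσc : ∀ᶠ w in 𝓝 v, ContinuousAt σ w := .of_forall fun _ => hσ.continuous.continuousAt
  have h₁ := (continuousAt_deriv_fst hσc
    (.of_forall fun w => by fun_prop)).eventually_ne hne₁
  have h₂ := (continuousAt_deriv_snd hσc
    (.of_forall fun w => by fun_prop)).eventually_ne hne₂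
  have hc : ∀ᶠ w in 𝓝 v, ContinuousAt (quotientFst σ F) w :=
    h₁.eventually_nhds.mono fun _ hw => continuousAt_quotientFst hσ hF hvan hw
  have hd₁ := h₁.mono fun _ hw => differentiableAt_quotientFst_fst hσ hF hvan hw
  have hd₂ := (hc.and h₂).mono fun _ hw => differentiableAt_quotientFst_snd hσ hF hw.1 hw.2
  filter_upwards [hc.eventually_nhds, hd₁.eventually_nhds, hd₂.eventually_nhds] with w hw hw₁ hw₂
  exact differentiableAt_of_separately hw hw₁ hw₂

end quotientFst

/-- A nonzero linear form on `ℂ²` is nonzero on both members of some basis. -/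
theorem exists_equiv_apply_ne_zero {l : ℂ × ℂ →L[ℂ] ℂ} (hl : l ≠ 0) :
    ∃ L : (ℂ × ℂ) ≃L[ℂ] (ℂ × ℂ), l (L (1, 0)) ≠ 0 ∧ l (L (0, 1)) ≠ 0 := by
  let p := ContinuousLinearMap.fst ℂ ℂ ℂ
  let q := ContinuousLinearMap.snd ℂ ℂ ℂ
  have hadd : l (1, 1) = l (1, 0) + l (0, 1) := by rw [← map_add]; simp
  by_cases ha : l (1, 0) = 0
  · have hb : l (0, 1) ≠ 0 := by
      refine fun hb => hl (ContinuousLinearMap.ext fun z => ?_)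
      have hz : z = z.1 • ((1, 0) : ℂ × ℂ) + z.2 • ((0, 1) : ℂ × ℂ) := by ext <;> simp
      rw [hz, map_add, map_smul, map_smul, ha, hb]
      simp
    refine ⟨ContinuousLinearEquiv.equivOfInverse (p.prod (p + q)) (p.prod (q - p))
      (fun z => by simp [p, q]) (fun z => by simp [p, q]), ?_, ?_⟩ <;>
    simp [p, q, hadd, ha, hb]
  · by_cases hb : l (0, 1) = 0
    · refine ⟨ContinuousLinearEquiv.equivOfInverse ((p + q).prod q) ((p - q).prod q)
        (fun z => by simp [p, q]) (fun z => by simp [p, q]), ?_, ?_⟩ <;>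
      simp [p, q, hadd, ha, hb]
    · exact ⟨.refl ℂ _, ha, hb⟩

theorem exists_eventually_eq_mul {σ F : ℂ × ℂ → ℂ} (hσ : Differentiable ℂ σ)
    (hF : Differentiable ℂ F) (hvan : ∀ u, σ u = 0 → F u = 0) {u : ℂ × ℂ}
    (hgrad : σ u = 0 → fderiv ℂ σ u ≠ 0) :
    ∃ G : ℂ × ℂ → ℂ, (∀ᶠ v in 𝓝 u, DifferentiableAt ℂ G v) ∧ ∀ v, F v = σ v * G v := by
  by_cases h : σ u = 0
  · obtain ⟨L, h₁, h₂⟩ := exists_equiv_apply_ne_zero (hgrad h)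
    obtain ⟨w, rfl⟩ := L.surjective u
    have hσL : Differentiable ℂ (σ ∘ L) := hσ.comp L.differentiable
    have hFL : Differentiable ℂ (F ∘ L) := hF.comp L.differentiable
    have hvanL : ∀ u, (σ ∘ L) u = 0 → (F ∘ L) u = 0 := fun u => hvan (L u)
    have hfd : HasFDerivAt (σ ∘ L) ((fderiv ℂ σ (L w)).comp (L : ℂ × ℂ →L[ℂ] ℂ × ℂ)) w :=
      (hσ (L w)).hasFDerivAt.comp w L.hasFDerivAt
    have hd₁ : HasDerivAt (fun x => (σ ∘ L) (x, w.2)) (fderiv ℂ σ (L w) (L (1, 0))) w.1 :=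
      HasFDerivAt.comp_hasDerivAt (f := fun x => (x, w.2)) w.1 hfd
        ((hasDerivAt_id w.1).prodMk (hasDerivAt_const w.1 w.2))
    have hd₂ : HasDerivAt (fun y => (σ ∘ L) (w.1, y)) (fderiv ℂ σ (L w) (L (0, 1))) w.2 :=
      HasFDerivAt.comp_hasDerivAt (f := fun y => (w.1, y)) w.2 hfd
        ((hasDerivAt_const w.2 w.1).prodMk (hasDerivAt_id w.2))
    refine ⟨quotientFst (σ ∘ L) (F ∘ L) ∘ L.symm, ?_, fun v => ?_⟩
    · have hev := eventually_differentiableAt_quotientFst hσL hFL hvanL (v := w)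
        (by rwa [hd₁.deriv]) (by rwa [hd₂.deriv])
      have ht : Tendsto L.symm (𝓝 (L w)) (𝓝 w) := by
        simpa using L.symm.continuous.tendsto (L w)
      filter_upwards [ht.eventually hev] with v hv
      exact hv.comp v L.symm.differentiableAt
    · simpa using mul_quotientFst (hvanL (L.symm v))
  · refine ⟨quotientFst σ F, ?_, fun v => mul_quotientFst (hvan v)⟩
    filter_upwards [hσ.continuous.continuousAt.eventually_ne h] with v hv
    exact differentiableAt_quotientFst_of_ne_zero hσ hF hv

/-- A holomorphic function has nonzero values arbitrarily near each zero where its gradient does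
not vanish. -/
theorem frequently_ne_zero {σ : ℂ × ℂ → ℂ} {u : ℂ × ℂ}
    (hgrad : σ u = 0 → fderiv ℂ σ u ≠ 0) : ∃ᶠ v in 𝓝 u, σ v ≠ 0 := by
  intro hev
  have hzero : σ =ᶠ[𝓝 u] fun _ => 0 := hev.mono fun _ hv => not_not.1 hv
  exact hgrad hzero.self_of_nhds (by rw [hzero.fderiv_eq, fderiv_const_apply])

/-- If `σ` is holomorphic on `ℂ²` with nonvanishing gradient on its zero set `W`,
and `F` is holomorphic vanishing on `W`, then `F = σ · G` for some holomorphic `G`. -/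
theorem stmt_1 (σ F : ℂ × ℂ → ℂ) (hσ : Differentiable ℂ σ)
    (hgrad : ∀ u : ℂ × ℂ, σ u = 0 → fderiv ℂ σ u ≠ 0)
    (hF : Differentiable ℂ F)
    (hvan : ∀ u : ℂ × ℂ, σ u = 0 → F u = 0) :
    ∃ G : ℂ × ℂ → ℂ, Differentiable ℂ G ∧ ∀ u, F u = σ u * G u := by
  choose G hG hFG using fun u => exists_eventually_eq_mul hσ hF hvan (hgrad u)
  refine ⟨fun u => G u u, fun u => ?_, fun u => hFG u u⟩
  refine (hG u).self_of_nhds.congr_of_eventuallyEq ?_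
  filter_upwards [hG u] with v hv
  by_contra hne
  have hcont : ContinuousAt (fun w => G v w - G u w) v :=
    (hG v).self_of_nhds.continuousAt.sub hv.continuousAt
  obtain ⟨w, hw, hw'⟩ := ((frequently_ne_zero (hgrad v)).and_eventually
    (hcont.eventually_ne (sub_ne_zero.2 hne))).exists
  exact hw' (sub_eq_zero.2 (mul_left_cancel₀ hw ((hFG v w).symm.trans (hFG u w))))
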